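/- arXiv:1711.06855 — 2 statements merged into one kernel-verified Lean document; each statement's English description precedes it below -/
import Mathlib

section
/- Let (ℱ_t^{(1)}) and (ℱ_t^{(2)}) be filtrations on a probability space (Ω, ℱ, ℙ) such that ℱ_∞^{(1)} = σ(⋃_t ℱ_t^{(1)}) and ℱ_∞^{(2)} = σ(⋃_t ℱ_t^{(2)}) are independent. For i ∈ {1,2}, let l^{(i)} be a binary-valued process adapted to (ℱ_t^{(i)}) such that for every t ∈ ℕ, ℙ[ l^{(i)}(t+1) = 0 ∣ ℱ_t^{(i)} ] ≤ p₀^{(i)} a.s. and ℙ[ l^{(i)}(t+1) = 1 ∣ ℱ_t^{(i)} ] ≤ p₁^{(i)} a.s., with p₀^{(i)}, p₁^{(i)} ∈ [0,1]. Define l̃(t) := l^{(1)}(t) ∧ l^{(2)}(t) and the join filtration ℱ_t := σ(ℱ_t^{(1)} ∪ ℱ_t^{(2)}). Then for every t ∈ ℕ, almost surely ℙ[ l̃(t+1) = 1 ∣ ℱ_t ] ≤ p₁^{(1)} p₁^{(2)} and ℙ[ l̃(t+1) = 0 ∣ ℱ_t ] ≤ min{ p₀^{(1)} + p₁^{(1)}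 p₀^{(2)}, p₀^{(2)} + p₁^{(2)} p₀^{(1)}, 1 }. -/
open MeasureTheory Filter Set ProbabilityTheory

lemma aux_indepFun {Ω : Type*} {G1 G2 m0 : MeasurableSpace Ω} {μ : Measure Ω}
    (h : Indep G1 G2 μ) {f g : Ω → ℝ} (hf : StronglyMeasurable[G1] f)
    (hg : StronglyMeasurable[G2] g) : IndepFun f g μ := by
  rw [IndepFun_iff_Indep]
  exact indep_of_indep_of_le_left (indep_of_indep_of_le_right h hg.measurable.comap_le)
    hf.measurable.comap_le

lemma aux_setInt {Ω : Type*} {G1 G2 m0 : MeasurableSpace Ω} {μ : Measure Ω}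
    (h1 : G1 ≤ m0) (h2 : G2 ≤ m0)
    (h : Indep G1 G2 μ) {f g : Ω → ℝ} (hf : StronglyMeasurable[G1] f)
    (hg : StronglyMeasurable[G2] g) {s t : Set Ω} (hs : MeasurableSet[G1] s)
    (ht : MeasurableSet[G2] t) :
    ∫ x in s ∩ t, f x * g x ∂μ = (∫ x in s, f x ∂μ) * ∫ x in t, g x ∂μ := by
  have hs' := h1 _ hs
  have ht' := h2 _ ht
  have hF := hf.indicator hs
  have hG := hg.indicator ht
  rw [← integral_indicator (hs'.inter ht'), ← integral_indicator hs', ← integral_indicator ht',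
    ← (aux_indepFun h hF hG).integral_fun_mul_eq_mul_integral
      (hF.mono h1).aestronglyMeasurable (hG.mono h2).aestronglyMeasurable]
  congr 1
  ext x
  by_cases hx : x ∈ s <;> by_cases hy : x ∈ t <;> simp [hx, hy]

lemma aux_condExp {Ω : Type*} {F1 F2 G1 G2 m0 : MeasurableSpace Ω} {μ : Measure Ω}
    [IsProbabilityMeasure μ] (h1 : G1 ≤ m0) (h2 : G2 ≤ m0) (hF1 : F1 ≤ G1) (hF2 : F2 ≤ G2)
    (h : Indep G1 G2 μ) {f g : Ω → ℝ} (hf : StronglyMeasurable[G1] f)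
    (hg : StronglyMeasurable[G2] g) (hfi : Integrable f μ) (hgi : Integrable g μ) :
    μ[fun x => f x * g x | F1 ⊔ F2] =ᵐ[μ] fun x => (μ[f | F1]) x * (μ[g | F2]) x := by
  have hm : F1 ⊔ F2 ≤ m0 := sup_le (hF1.trans h1) (hF2.trans h2)
  have hcf : StronglyMeasurable[F1] (μ[f | F1]) := stronglyMeasurable_condExp
  have hcg : StronglyMeasurable[F2] (μ[g | F2]) := stronglyMeasurable_condExp
  have hi : Integrable (fun x => f x * g x) μ := (aux_indepFun h hf hg).integrable_mul hfi hgi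
  have hci : Integrable (fun x => (μ[f | F1]) x * (μ[g | F2]) x) μ :=
    (aux_indepFun h (hcf.mono hF1) (hcg.mono hF2)).integrable_mul
      integrable_condExp integrable_condExp
  have hpi : ∀ s t, MeasurableSet[F1] s → MeasurableSet[F2] t →
      ∫ x in s ∩ t, (μ[f | F1]) x * (μ[g | F2]) x ∂μ = ∫ x in s ∩ t, f x * g x ∂μ := by
    intro s t hs ht
    rw [aux_setInt h1 h2 h (hcf.mono hF1) (hcg.mono hF2) (hF1 _ hs) (hF2 _ ht),
      aux_setInt h1 h2 h hf hg (hF1 _ hs) (hF2 _ ht),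
      setIntegral_condExp (hF1.trans h1) hfi hs, setIntegral_condExp (hF2.trans h2) hgi ht]
  symm
  refine ae_eq_condExp_of_forall_setIntegral_eq hm hi (fun s _ _ => hci.integrableOn) ?_
    (StronglyMeasurable.aestronglyMeasurable
      ((hcf.mono le_sup_left).mul (hcg.mono le_sup_right)))
  intro s hs _
  have hgen : F1 ⊔ F2 = MeasurableSpace.generateFrom
      {u | ∃ s t, MeasurableSet[F1] s ∧ MeasurableSet[F2] t ∧ s ∩ t = u} := by
    apply le_antisymm
    · refine sup_le (fun u hu => ?_) (fun u hu => ?_)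
      · exact MeasurableSpace.measurableSet_generateFrom
          ⟨u, univ, hu, @MeasurableSet.univ _ F2, inter_univ u⟩
      · exact MeasurableSpace.measurableSet_generateFrom
          ⟨univ, u, @MeasurableSet.univ _ F1, hu, univ_inter u⟩
    · refine MeasurableSpace.generateFrom_le ?_
      rintro _ ⟨s, t, hs, ht, rfl⟩
      exact @MeasurableSet.inter _ (F1 ⊔ F2) _ _
        ((le_sup_left : F1 ≤ F1 ⊔ F2) _ hs) ((le_sup_right : F2 ≤ F1 ⊔ F2) _ ht)
  have huniv : ∫ x, (μ[f | F1]) x * (μ[g | F2]) x ∂μ = ∫ x, f x * g x ∂μ := by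
    simpa using hpi univ univ (@MeasurableSet.univ _ F1) (@MeasurableSet.univ _ F2)
  induction s, hs using MeasurableSpace.induction_on_inter hgen with
  | h_inter =>
    rintro _ ⟨s, t, hs, ht, rfl⟩ _ ⟨s', t', hs', ht', rfl⟩ _
    exact ⟨s ∩ s', t ∩ t', @MeasurableSet.inter _ F1 _ _ hs hs',
      @MeasurableSet.inter _ F2 _ _ ht ht', inter_inter_inter_comm _ _ _ _⟩
  | empty => simp
  | basic u hu =>
    obtain ⟨s, t, hs, ht, rfl⟩ := hu
    exact hpi s t hs ht
  | compl u hu ih =>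
    have e := ih (measure_lt_top _ _)
    rw [setIntegral_compl (hm _ hu) hci, setIntegral_compl (hm _ hu) hi, e, huniv]
  | iUnion u hd hu ih =>
    rw [integral_iUnion (fun i => hm _ (hu i)) hd hci.integrableOn,
      integral_iUnion (fun i => hm _ (hu i)) hd hi.integrableOn]
    congr 1
    ext i
    exact ih i (measure_lt_top _ _)

/-- Theorem 3.2 (filtration form): if `l⁽¹⁾` and `l⁽²⁾` are binary processes
adapted to independent filtrations and satisfying the `Γ`-type conditional
bounds with parameters `(p₀⁽ⁱ⁾, p₁⁽ⁱ⁾)`, then `l̃(t) = l⁽¹⁾(t) ∧ l⁽²⁾(t)`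
satisfies the `Γ`-type bounds with parameters
`p̃₀ = min{p₀⁽¹⁾+p₁⁽¹⁾p₀⁽²⁾, p₀⁽²⁾+p₁⁽²⁾p₀⁽¹⁾, 1}` and `p̃₁ = p₁⁽¹⁾p₁⁽²⁾`
with respect to the join filtration. -/
theorem and_hidden_markov {Ω : Type*} {m0 : MeasurableSpace Ω} {μ : Measure Ω}
    [IsProbabilityMeasure μ] (ℱ1 ℱ2 : Filtration ℕ m0)
    (hindep : Indep (⨆ t, (ℱ1 t : MeasurableSpace Ω))
      (⨆ t, (ℱ2 t : MeasurableSpace Ω)) μ)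
    (l1 l2 : ℕ → Ω → ℕ)
    (hbin1 : ∀ t ω, l1 t ω ≤ 1) (hbin2 : ∀ t ω, l2 t ω ≤ 1)
    (hadp1 : ∀ t, Measurable[ℱ1 t] (l1 t)) (hadp2 : ∀ t, Measurable[ℱ2 t] (l2 t))
    {p01 p11 p02 p12 : ℝ}
    (hp01 : p01 ∈ Set.Icc (0 : ℝ) 1) (hp11 : p11 ∈ Set.Icc (0 : ℝ) 1)
    (hp02 : p02 ∈ Set.Icc (0 : ℝ) 1) (hp12 : p12 ∈ Set.Icc (0 : ℝ) 1)
    (hcond10 : ∀ t, ∀ᵐ ω ∂μ,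
      (μ[Set.indicator {ω' | l1 (t + 1) ω' = 0} (fun _ => (1 : ℝ)) | ℱ1 t]) ω ≤ p01)
    (hcond11 : ∀ t, ∀ᵐ ω ∂μ,
      (μ[Set.indicator {ω' | l1 (t + 1) ω' = 1} (fun _ => (1 : ℝ)) | ℱ1 t]) ω ≤ p11)
    (hcond20 : ∀ t, ∀ᵐ ω ∂μ,
      (μ[Set.indicator {ω' | l2 (t + 1) ω' = 0} (fun _ => (1 : ℝ)) | ℱ2 t]) ω ≤ p02)
    (hcond21 : ∀ t, ∀ᵐ ω ∂μ,
      (μ[Set.indicator {ω' | l2 (t + 1) ω' = 1} (fun _ => (1 : ℝ)) | ℱ2 t]) ω ≤ p12) :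
    ∀ t : ℕ,
      (∀ᵐ ω ∂μ,
        (μ[Set.indicator {ω' | min (l1 (t + 1) ω') (l2 (t + 1) ω') = 1}
            (fun _ => (1 : ℝ)) | (ℱ1 t : MeasurableSpace Ω) ⊔ (ℱ2 t : MeasurableSpace Ω)]) ω
          ≤ p11 * p12) ∧
      (∀ᵐ ω ∂μ,
        (μ[Set.indicator {ω' | min (l1 (t + 1) ω') (l2 (t + 1) ω') = 0}
            (fun _ => (1 : ℝ)) | (ℱ1 t : MeasurableSpace Ω) ⊔ (ℱ2 t : MeasurableSpace Ω)]) ω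
          ≤ min (min (p01 + p11 * p02) (p02 + p12 * p01)) 1) := by
  intro t
  have hG1 : (⨆ t, (ℱ1 t : MeasurableSpace Ω)) ≤ m0 := iSup_le fun t => ℱ1.le t
  have hG2 : (⨆ t, (ℱ2 t : MeasurableSpace Ω)) ≤ m0 := iSup_le fun t => ℱ2.le t
  have hF1 : ∀ t, ℱ1 t ≤ (⨆ t, (ℱ1 t : MeasurableSpace Ω)) :=
    fun t => le_iSup (fun t => (ℱ1 t : MeasurableSpace Ω)) t
  have hF2 : ∀ t, ℱ2 t ≤ (⨆ t, (ℱ2 t : MeasurableSpace Ω)) :=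
    fun t => le_iSup (fun t => (ℱ2 t : MeasurableSpace Ω)) t
  let f : ℕ → Ω → ℝ := fun k => Set.indicator {ω' | l1 (t + 1) ω' = k} (fun _ => (1 : ℝ))
  let g : ℕ → Ω → ℝ := fun k => Set.indicator {ω' | l2 (t + 1) ω' = k} (fun _ => (1 : ℝ))
  have hf : ∀ k, StronglyMeasurable[⨆ t, (ℱ1 t : MeasurableSpace Ω)] (f k) := fun k =>
    stronglyMeasurable_const.indicator
      (hF1 (t + 1) _ (hadp1 (t + 1) (measurableSet_singleton k)))
  have hg : ∀ k, StronglyMeasurable[⨆ t, (ℱ2 t : MeasurableSpace Ω)] (g k) := fun k =>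
    stronglyMeasurable_const.indicator
      (hF2 (t + 1) _ (hadp2 (t + 1) (measurableSet_singleton k)))
  have hfi : ∀ k, Integrable (f k) μ := fun k => (integrable_const (1 : ℝ)).indicator
      (ℱ1.le (t + 1) _ (hadp1 (t + 1) (measurableSet_singleton k)))
  have hgi : ∀ k, Integrable (g k) μ := fun k => (integrable_const (1 : ℝ)).indicator
      (ℱ2.le (t + 1) _ (hadp2 (t + 1) (measurableSet_singleton k)))
  have hf0 : ∀ k, 0 ≤ᵐ[μ] μ[f k | ℱ1 t] := fun k => condExp_nonneg
    (Eventually.of_forall fun ω => Set.indicator_nonneg (fun _ _ => zero_le_one) ω)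
  have hg0 : ∀ k, 0 ≤ᵐ[μ] μ[g k | ℱ2 t] := fun k => condExp_nonneg
    (Eventually.of_forall fun ω => Set.indicator_nonneg (fun _ _ => zero_le_one) ω)
  have key : ∀ i j, μ[fun x => f i x * g j x | (ℱ1 t : MeasurableSpace Ω) ⊔ ℱ2 t] =ᵐ[μ]
      fun x => (μ[f i | ℱ1 t]) x * (μ[g j | ℱ2 t]) x := fun i j =>
    aux_condExp hG1 hG2 (hF1 t) (hF2 t) hindep (hf i) (hg j) (hfi i) (hgi j)
  have hprodi : ∀ i j, Integrable (fun x => f i x * g j x) μ := fun i j =>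
    (aux_indepFun hindep (hf i) (hg j)).integrable_mul (hfi i) (hgi j)
  have hm : (ℱ1 t : MeasurableSpace Ω) ⊔ ℱ2 t ≤ m0 := sup_le (ℱ1.le t) (ℱ2.le t)
  have keyf : μ[f 0 | (ℱ1 t : MeasurableSpace Ω) ⊔ ℱ2 t] =ᵐ[μ] μ[f 0 | ℱ1 t] := by
    have := aux_condExp hG1 hG2 (hF1 t) (hF2 t) hindep (hf 0)
      (stronglyMeasurable_const (β := ℝ) (b := 1)) (hfi 0) (integrable_const 1)
    simpa [condExp_const (ℱ2.le t)] using this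
  have keyg : μ[g 0 | (ℱ1 t : MeasurableSpace Ω) ⊔ ℱ2 t] =ᵐ[μ] μ[g 0 | ℱ2 t] := by
    have := aux_condExp hG1 hG2 (hF1 t) (hF2 t) hindep
      (stronglyMeasurable_const (β := ℝ) (b := 1)) (hg 0) (integrable_const 1) (hgi 0)
    simpa [condExp_const (ℱ1.le t)] using this
  have e1 : Set.indicator {ω' | min (l1 (t + 1) ω') (l2 (t + 1) ω') = 1}
      (fun _ => (1 : ℝ)) = fun x => f 1 x * g 1 x := by
    ext x
    have a := hbin1 (t + 1) x
    have b := hbin2 (t + 1) x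
    simp only [f, g, Set.indicator, Set.mem_ofPred_eq]
    rcases Nat.le_one_iff_eq_zero_or_eq_one.mp a with a | a <;>
      rcases Nat.le_one_iff_eq_zero_or_eq_one.mp b with b | b <;> simp [a, b]
  have e2 : Set.indicator {ω' | min (l1 (t + 1) ω') (l2 (t + 1) ω') = 0}
      (fun _ => (1 : ℝ)) = f 0 + fun x => f 1 x * g 0 x := by
    ext x
    have a := hbin1 (t + 1) x
    have b := hbin2 (t + 1) x
    simp only [f, g, Set.indicator, Set.mem_ofPred_eq, Pi.add_apply]
    rcases Nat.le_one_iff_eq_zero_or_eq_one.mp a with a | a <;>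
      rcases Nat.le_one_iff_eq_zero_or_eq_one.mp b with b | b <;> simp [a, b]
  have e3 : (f 0 + fun x => f 1 x * g 0 x) = g 0 + fun x => f 0 x * g 1 x := by
    ext x
    have a := hbin1 (t + 1) x
    have b := hbin2 (t + 1) x
    simp only [f, g, Set.indicator, Set.mem_ofPred_eq, Pi.add_apply]
    rcases Nat.le_one_iff_eq_zero_or_eq_one.mp a with a | a <;>
      rcases Nat.le_one_iff_eq_zero_or_eq_one.mp b with b | b <;> simp [a, b]
  refine ⟨?_, ?_⟩
  · rw [e1]
    filter_upwards [key 1 1, hcond11 t, hcond21 t, hg0 1] with ω h1 h2 h3 h4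
    rw [h1]
    exact mul_le_mul h2 h3 h4 hp11.1
  · have hle : μ[Set.indicator {ω' | min (l1 (t + 1) ω') (l2 (t + 1) ω') = 0}
        (fun _ => (1 : ℝ)) | (ℱ1 t : MeasurableSpace Ω) ⊔ ℱ2 t] ≤ᵐ[μ] fun _ => (1 : ℝ) := by
      refine EventuallyLE.trans_eq ?_
        (Eventually.of_forall (congrFun (condExp_const (μ := μ) hm (1 : ℝ))))
      refine condExp_mono ?_ (integrable_const 1) (Eventually.of_forall fun ω => ?_)
      · rw [e2]
        exact (hfi 0).add (hprodi 1 0)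
      · exact Set.indicator_le_self' (fun _ _ => zero_le_one) ω
    have a1 := condExp_add (hfi 0) (hprodi 1 0) ((ℱ1 t : MeasurableSpace Ω) ⊔ ℱ2 t)
    have a2 := condExp_add (hgi 0) (hprodi 0 1) ((ℱ1 t : MeasurableSpace Ω) ⊔ ℱ2 t)
    rw [← e3] at a2
    rw [e2] at hle ⊢
    filter_upwards [hle, a1, a2, keyf, keyg, key 1 0, key 0 1, hcond10 t, hcond11 t, hcond20 t,
      hcond21 t, hg0 0, hf0 0] with ω hle a1 a2 kf kg k10 k01 c10 c11 c20 c21 g0 f0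
    refine le_min (le_min ?_ ?_) hle
    · rw [a1, Pi.add_apply, kf, k10]
      exact add_le_add c10 (mul_le_mul c11 c20 g0 hp11.1)
    · rw [a2, Pi.add_apply, kg, k01, mul_comm]
      exact add_le_add c20 (mul_le_mul c21 c10 f0 hp12.1)
end

section
/- Let p̃ ∈ (0,1), w̃ ∈ (0,1], and ρ ∈ (p̃w̃, w̃), and define φ := (ρ/w̃)(1−p̃) / ( p̃(1 − ρ/w̃) ). Then φ > 1 and φ^{−ρ} · ((φ−1)p̃ + 1)^{w̃} < 1. -/
open Real

/-- The key analytic inequality in the proof of the tail-bound lemma: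
for `p̃ ∈ (0,1)`, `w̃ ∈ (0,1]` and `ρ ∈ (p̃w̃, w̃)`, the quantity
`φ = (ρ/w̃)(1−p̃)/(p̃(1−ρ/w̃))` satisfies `φ > 1` and
`φ^{−ρ} ((φ−1)p̃ + 1)^{w̃} < 1`. -/
theorem phi_inequality {p w ρ : ℝ}
    (hp : p ∈ Set.Ioo (0 : ℝ) 1) (hw : w ∈ Set.Ioc (0 : ℝ) 1)
    (hρ : ρ ∈ Set.Ioo (p * w) w) :
    1 < (ρ / w) * (1 - p) / (p * (1 - ρ / w)) ∧
      ((ρ / w) * (1 - p) / (p * (1 - ρ / w))) ^ (-ρ) *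
        (((ρ / w) * (1 - p) / (p * (1 - ρ / w)) - 1) * p + 1) ^ w < 1 := by
  obtain ⟨hp0, hp1⟩ := hp
  obtain ⟨hw0, -⟩ := hw
  obtain ⟨h1, h2⟩ := hρ
  obtain ⟨r, hr⟩ : ∃ r, r = ρ / w := ⟨_, rfl⟩
  have hρr : ρ = r * w := by rw [hr]; field_simp
  rw [← hr]
  have hpr : p < r := by rw [hr, lt_div_iff₀ hw0]; exact h1
  have hr1 : r < 1 := by rw [hr, div_lt_one hw0]; exact h2
  have hr0 : 0 < r := hp0.trans hpr
  have hq : 0 < 1 - r := by linarith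
  have hq' : 0 < 1 - p := by linarith
  have hφ : 1 < r * (1 - p) / (p * (1 - r)) := by
    rw [lt_div_iff₀ (by positivity)]; nlinarith
  refine ⟨hφ, ?_⟩
  have e1 : (r * (1 - p) / (p * (1 - r)) - 1) * p + 1 = (1 - p) / (1 - r) := by
    field_simp
    ring
  have e2 : r * (1 - p) / (p * (1 - r)) = ((1 - p) / (1 - r)) / (p / r) := by
    field_simp
  have ha : 0 < p / r := by positivity
  have hb : 0 < (1 - p) / (1 - r) := by positivity
  have l1 : Real.log (p / r) < p / r - 1 :=
    Real.log_lt_sub_one_of_pos ha (by rw [Ne, div_eq_one_iff_eq hr0.ne']; exact hpr.ne)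
  have l2 : Real.log ((1 - p) / (1 - r)) ≤ (1 - p) / (1 - r) - 1 :=
    Real.log_le_sub_one_of_pos hb
  have m1 : r * Real.log (p / r) < p - r := by
    have h := mul_lt_mul_of_pos_left l1 hr0
    have h' : r * (p / r - 1) = p - r := by field_simp
    linarith
  have m2 : (1 - r) * Real.log ((1 - p) / (1 - r)) ≤ r - p := by
    have h := mul_le_mul_of_nonneg_left l2 hq.le
    have h' : (1 - r) * ((1 - p) / (1 - r) - 1) = r - p := by
      field_simp
      ring
    linarith
  rw [e1, e2, Real.rpow_def_of_pos (by positivity), Real.rpow_def_of_pos hb, ← Real.exp_add,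
    Real.exp_lt_one_iff, Real.log_div hb.ne' ha.ne', hρr]
  have h := mul_neg_of_pos_of_neg hw0 (show r * Real.log (p / r) +
    (1 - r) * Real.log ((1 - p) / (1 - r)) < 0 by linarith)
  linarith
end
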